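/- Let M be a spacelike surface in ℝ^{3,1} with a canonical normal null direction Z. Then the Gauss curvature of M is given by K = a β(Z^⊤). -/

import Mathlib

noncomputable section

/-- Points of the parameter domain of the surface chart. -/
abbrev Pt : Type := ℝ × ℝ

/-- Vectors of the Minkowski space `ℝ^{3,1}`. -/
abbrev E4 : Type := Fin 4 → ℝ

/-- The Minkowski bilinear form of signature `(+,+,+,-)` on `ℝ⁴`. -/
def mink (v w : E4) : ℝ := v 0 * w 0 + v 1 * w 1 + v 2 * w 2 - v 3 * w 3

/-- Realization in `ℝ^{3,1}` of a coordinate vector field `X` along the immersion `ψ`. -/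
def vecF (ψ : Pt → E4) (X : Pt → Pt) : Pt → E4 := fun p => fderiv ℝ ψ p (X p)

/-- Flat (ambient) derivative of an `ℝ⁴`-valued field along a coordinate vector field. -/
def Dflat (X : Pt → Pt) (V : Pt → E4) : Pt → E4 := fun p => fderiv ℝ V p (X p)

/-- Second fundamental form `B(X,Y) = ∇̄_X Y − ∇_X Y`. -/
def sff (ψ : Pt → E4) (conn : (Pt → Pt) → (Pt → Pt) → Pt → Pt) (X Y : Pt → Pt) : Pt → E4 :=
  fun p => Dflat X (vecF ψ Y) p - vecF ψ (conn X Y) p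

/-- `v` is tangent to the surface at `p`. -/
def isTangentV (ψ : Pt → E4) (p : Pt) (v : E4) : Prop := ∃ w : Pt, fderiv ℝ ψ p w = v

/-- `v` is normal to the surface at `p`. -/
def isNormalV (ψ : Pt → E4) (p : Pt) (v : E4) : Prop := ∀ w : Pt, mink v (fderiv ℝ ψ p w) = 0

/-- Lie bracket of coordinate vector fields on the chart. -/
def lieB (X Y : Pt → Pt) : Pt → Pt := fun p => fderiv ℝ Y p (X p) - fderiv ℝ X p (Y p)

/-- Curvature tensor `R(X,Y)V = ∇_Y∇_X V − ∇_X∇_Y V + ∇_{[X,Y]}V`. -/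
def curvR (conn : (Pt → Pt) → (Pt → Pt) → Pt → Pt) (X Y V : Pt → Pt) : Pt → Pt :=
  fun p => conn Y (conn X V) p - conn X (conn Y V) p + conn (lieB X Y) V p

/-- Normal curvature tensor `R^⊥(X,Y)ν = ∇⊥_Y∇⊥_X ν − ∇⊥_X∇⊥_Y ν + ∇⊥_{[X,Y]}ν`. -/
def curvRperp (nconn : (Pt → Pt) → (Pt → E4) → Pt → E4) (X Y : Pt → Pt) (ν : Pt → E4) :
    Pt → E4 :=
  fun p => nconn Y (nconn X ν) p - nconn X (nconn Y ν) p + nconn (lieB X Y) ν p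

/-- Determinant of four vectors of `ℝ⁴` (the volume form `e₁∧e₂∧e₃∧e₄ ↦ 1`). -/
def det4 (a b c d : E4) : ℝ := Matrix.det (Matrix.of ![a, b, c, d])

/-- A spacelike surface in `ℝ^{3,1}`, given by a chart `ψ : U → ℝ^{3,1}`, endowed with a
canonical normal null direction with respect to the constant unit spacelike vector `Z`,
together with all the associated geometric data: the Levi-Civita connection `conn`,
the normal connection `nconn`, the tangent part `Z^⊤` (coordinates `ZT`), the oriented
orthonormal completion `W` (coordinates `Wc`), the shape operator `shA = A_{Z^⊥}`,
the 1-form `β` with `B(X,Z^⊤) = β(X)Z^⊥`, and the lightlike normal field `W'` with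
`⟨Z^⊥,W'⟩ = 1`.  Each piece of data is characterized by its defining property. -/
structure CNND where
  U : Set Pt
  hUopen : IsOpen U
  ψ : Pt → E4
  hψ : ContDiffOn ℝ (⊤ : ℕ∞) ψ U
  himm : ∀ p ∈ U, ∀ v : Pt, fderiv ℝ ψ p v = 0 → v = 0
  hspacelike : ∀ p ∈ U, ∀ v : Pt, v ≠ 0 → 0 < mink (fderiv ℝ ψ p v) (fderiv ℝ ψ p v)
  /-- Levi-Civita connection of the induced metric, as the tangent part of the flat one. -/
  conn : (Pt → Pt) → (Pt → Pt) → Pt → Pt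
  hconn : ∀ X Y, ∀ p ∈ U, DifferentiableAt ℝ (vecF ψ Y) p → isNormalV ψ p (sff ψ conn X Y p)
  hconnSmooth : ∀ X Y, ContDiffOn ℝ (⊤ : ℕ∞) X U → ContDiffOn ℝ (⊤ : ℕ∞) Y U → ContDiffOn ℝ (⊤ : ℕ∞) (conn X Y) U
  /-- Normal connection: the normal part of the flat derivative of a normal field. -/
  nconn : (Pt → Pt) → (Pt → E4) → Pt → E4
  hnconn : ∀ X ν, ∀ p ∈ U, (∀ q ∈ U, isNormalV ψ q (ν q)) → DifferentiableAt ℝ ν p →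
    isNormalV ψ p (nconn X ν p) ∧ isTangentV ψ p (Dflat X ν p - nconn X ν p)
  hnconnSmooth : ∀ X ν, ContDiffOn ℝ (⊤ : ℕ∞) X U → (∀ q ∈ U, isNormalV ψ q (ν q)) →
    ContDiffOn ℝ (⊤ : ℕ∞) ν U → ContDiffOn ℝ (⊤ : ℕ∞) (nconn X ν) U
  /-- The parallel (constant) vector field `Z`, a unit spacelike vector. -/
  Z : E4
  hZunit : mink Z Z = 1
  /-- Coordinates of the tangent part `Z^⊤` of `Z`; `Z^⊥ = Z − Z^⊤` is normal. -/
  ZT : Pt → Pt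
  hZTsmooth : ContDiffOn ℝ (⊤ : ℕ∞) ZT U
  hZTtangentpart : ∀ p ∈ U, isNormalV ψ p (Z - fderiv ℝ ψ p (ZT p))
  /-- canonical normal null direction: `Z^⊥` is lightlike … -/
  hZperpNull : ∀ p ∈ U, mink (Z - fderiv ℝ ψ p (ZT p)) (Z - fderiv ℝ ψ p (ZT p)) = 0
  /-- … and nowhere zero. -/
  hZperpNe : ∀ p ∈ U, Z - fderiv ℝ ψ p (ZT p) ≠ 0
  /-- Coordinates of the unit tangent field `W` orthogonal to `Z^⊤`, positively oriented. -/
  Wc : Pt → Pt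
  hWsmooth : ContDiffOn ℝ (⊤ : ℕ∞) Wc U
  hWunit : ∀ p ∈ U, mink (fderiv ℝ ψ p (Wc p)) (fderiv ℝ ψ p (Wc p)) = 1
  hWorth : ∀ p ∈ U, mink (fderiv ℝ ψ p (ZT p)) (fderiv ℝ ψ p (Wc p)) = 0
  hWorient : ∀ p ∈ U, 0 < (ZT p).1 * (Wc p).2 - (ZT p).2 * (Wc p).1
  /-- The shape operator `A_{Z^⊥}`: `⟨A_{Z^⊥}X, Y⟩ = ⟨B(X,Y), Z^⊥⟩`. -/
  shA : (Pt → Pt) → Pt → Pt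
  hshA : ∀ X Y, ∀ p ∈ U, DifferentiableAt ℝ (vecF ψ Y) p →
    mink (fderiv ℝ ψ p (shA X p)) (fderiv ℝ ψ p (Y p)) =
      mink (sff ψ conn X Y p) (Z - fderiv ℝ ψ p (ZT p))
  /-- The 1-form `β` with `B(X, Z^⊤) = β(X) Z^⊥`. -/
  beta : Pt → Pt → ℝ
  hbeta : ∀ X, ∀ p ∈ U, sff ψ conn X ZT p = beta p (X p) • (Z - fderiv ℝ ψ p (ZT p))
  /-- The lightlike normal field `W'` with `⟨Z^⊥, W'⟩ = 1`, such that
  `(Z^⊤, W, (Z^⊥+W')/√2, (Z^⊥−W')/√2)` is a positively oriented orthonormal frame. -/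
  Wp : Pt → E4
  hWpNormal : ∀ p ∈ U, isNormalV ψ p (Wp p)
  hWpNull : ∀ p ∈ U, mink (Wp p) (Wp p) = 0
  hWpPair : ∀ p ∈ U, mink (Z - fderiv ℝ ψ p (ZT p)) (Wp p) = 1
  hWpOrient : ∀ p ∈ U, 0 < det4 (fderiv ℝ ψ p (ZT p)) (fderiv ℝ ψ p (Wc p))
    ((Real.sqrt 2)⁻¹ • ((Z - fderiv ℝ ψ p (ZT p)) + Wp p))
    ((Real.sqrt 2)⁻¹ • ((Z - fderiv ℝ ψ p (ZT p)) - Wp p))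

namespace CNND

variable (S : CNND)

/-- The normal part `Z^⊥` of `Z` along the surface. -/
def Zperp : Pt → E4 := fun p => S.Z - fderiv ℝ S.ψ p (S.ZT p)

/-- The second fundamental form of the surface. -/
def B : (Pt → Pt) → (Pt → Pt) → Pt → E4 := sff S.ψ S.conn

/-- The function `a = α(W) = ⟨B(W,W), Z^⊥⟩`. -/
def afun : Pt → ℝ := fun p => mink (S.B S.Wc S.Wc p) (S.Zperp p)

/-- The 1-form `α(X) = ⟨B(X,W), Z^⊥⟩`. -/
def alphaF (X : Pt → Pt) : Pt → ℝ := fun p => mink (S.B X S.Wc p) (S.Zperp p)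

/-- The mean curvature vector `H⃗ = (1/2)(B(Z^⊤,Z^⊤) + B(W,W))`. -/
def Hvec : Pt → E4 := fun p => (1 / 2 : ℝ) • (S.B S.ZT S.ZT p + S.B S.Wc S.Wc p)

/-- The Gauss curvature `K = ⟨R(Z^⊤,W)Z^⊤, W⟩`. -/
def Kfun : Pt → ℝ := fun p =>
  mink (fderiv ℝ S.ψ p (curvR S.conn S.ZT S.Wc S.ZT p)) (fderiv ℝ S.ψ p (S.Wc p))

/-- The normal curvature `K_N = ⟨R^⊥(Z^⊤,W)Z^⊥, W'⟩`. -/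
def KNfun : Pt → ℝ := fun p => mink (curvRperp S.nconn S.ZT S.Wc S.Zperp p) (S.Wp p)

end CNND

/-- The wedge `v ∧ w` of two vectors of `ℝ⁴`, as an antisymmetric matrix (bivector). -/
def wedge2 (v w : E4) : Fin 4 → Fin 4 → ℝ := fun i j => v i * w j - v j * w i

/-- The Gauss map `G = Z^⊤ ∧ W : M → Λ²ℝ^{3,1}`. -/
def CNND.Gmap (S : CNND) : Pt → Fin 4 → Fin 4 → ℝ :=
  fun p => wedge2 (fderiv ℝ S.ψ p (S.ZT p)) (fderiv ℝ S.ψ p (S.Wc p))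

/-- The signs of the Minkowski metric. -/
def epsM : Fin 4 → ℝ := fun i => if i = 3 then -1 else 1

/-- The induced (signature `(3,3)`) inner product on bivectors of `ℝ^{3,1}`:
`⟨v∧w, v'∧w'⟩ = ⟨v,v'⟩⟨w,w'⟩ − ⟨v,w'⟩⟨w,v'⟩`. -/
def binner (η η' : Fin 4 → Fin 4 → ℝ) : ℝ :=
  (1 / 2) * ∑ i : Fin 4, ∑ j : Fin 4, epsM i * epsM j * η i j * η' i j

/-- The wedge product `Λ²ℝ^{3,1} × Λ²ℝ^{3,1} → Λ⁴ℝ^{3,1} ≅ ℝ`, normalized so that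
`(v∧w)∧(v'∧w') = det(v,w,v',w')`. -/
def bwedge (η η' : Fin 4 → Fin 4 → ℝ) : ℝ :=
  (1 / 4) * ∑ σ : Equiv.Perm (Fin 4),
    ((Equiv.Perm.sign σ : ℤ) : ℝ) * η (σ 0) (σ 1) * η' (σ 2) (σ 3)

/-- The `ℂ`-bilinear form `H(η,η') = ⟨η,η'⟩ + i η∧η'` on bivectors, where `i = −⋆`. -/
def HformC (η η' : Fin 4 → Fin 4 → ℝ) : ℂ :=
  (binner η η' : ℝ) + (bwedge η η' : ℝ) * Complex.I

/-- The quadratic form `δ(u) = dG(u) ∧ dG(u)` whose zero directions are the asymptotic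
directions. -/
def CNND.deltaQ (S : CNND) (p : Pt) (u : Pt) : ℝ :=
  bwedge (fderiv ℝ S.Gmap p u) (fderiv ℝ S.Gmap p u)

theorem mink_add_left (u v w : E4) : mink (u + v) w = mink u w + mink v w := by
  simp only [mink, Pi.add_apply]; ring

theorem mink_sub_left (u v w : E4) : mink (u - v) w = mink u w - mink v w := by
  simp only [mink, Pi.sub_apply]; ring

theorem mink_smul_left (c : ℝ) (v w : E4) : mink (c • v) w = c * mink v w := by
  simp only [mink, Pi.smul_apply, smul_eq_mul]; ring

theorem mink_comm (v w : E4) : mink v w = mink w v := by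
  simp only [mink]; ring

/-- Leibniz rule for the Minkowski form applied to two orthogonal fields. -/
theorem mink_fderiv_of_orthogonal {A V : Pt → E4} {p : Pt} (hA : DifferentiableAt ℝ A p)
    (hV : DifferentiableAt ℝ V p) (h : ∀ᶠ q in nhds p, mink (A q) (V q) = 0) (x : Pt) :
    mink (fderiv ℝ A p x) (V p) = -mink (A p) (fderiv ℝ V p x) := by
  have hAi := hasFDerivAt_pi'.1 hA.hasFDerivAt
  have hVi := hasFDerivAt_pi'.1 hV.hasFDerivAt
  have hd := ((((hAi 0).mul (hVi 0)).add ((hAi 1).mul (hVi 1))).add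
    ((hAi 2).mul (hVi 2))).sub ((hAi 3).mul (hVi 3))
  have h0 : HasFDerivAt (fun q => mink (A q) (V q)) (0 : Pt →L[ℝ] ℝ) p :=
    (hasFDerivAt_const (0 : ℝ) p).congr_of_eventuallyEq h
  have key := congrArg (fun L : Pt →L[ℝ] ℝ => L x) (hd.unique h0)
  simp at key
  simp only [mink]
  linarith

/-- Expansion of an iterated flat derivative. -/
theorem Dflat_Dflat {V : Pt → E4} {X Y : Pt → Pt} {p : Pt}
    (hV : DifferentiableAt ℝ (fderiv ℝ V) p) (hX : DifferentiableAt ℝ X p) :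
    Dflat Y (Dflat X V) p =
      fderiv ℝ (fderiv ℝ V) p (Y p) (X p) + fderiv ℝ V p (fderiv ℝ X p (Y p)) := by
  unfold Dflat
  rw [fderiv_clm_apply hV hX]
  simp [add_comm]

/-- The flat connection has no curvature. -/
theorem Dflat_comm {V : Pt → E4} {X Y : Pt → Pt} {p : Pt}
    (hV : ContDiffAt ℝ (⊤ : ℕ∞) V p) (hX : DifferentiableAt ℝ X p)
    (hY : DifferentiableAt ℝ Y p) :
    Dflat Y (Dflat X V) p - Dflat X (Dflat Y V) p + Dflat (lieB X Y) V p = 0 := by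
  have hV' : DifferentiableAt ℝ (fderiv ℝ V) p :=
    (hV.fderiv_right (m := 1) (by norm_cast)).differentiableAt (by norm_num)
  have hs := (hV.isSymmSndFDerivAt (by simp; norm_cast)).eq (X p) (Y p)
  rw [Dflat_Dflat hV' hX, Dflat_Dflat hV' hY, hs]
  simp only [Dflat, lieB, map_sub]
  abel

namespace CNND

variable (S : CNND)

theorem contDiffOn_Dflat {X : Pt → Pt} {V : Pt → E4} (hX : ContDiffOn ℝ (⊤ : ℕ∞) X S.U)
    (hV : ContDiffOn ℝ (⊤ : ℕ∞) V S.U) : ContDiffOn ℝ (⊤ : ℕ∞) (Dflat X V) S.U :=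
  (hV.fderiv_of_isOpen S.hUopen (by norm_cast)).clm_apply hX

theorem contDiffOn_vecF {X : Pt → Pt} (hX : ContDiffOn ℝ (⊤ : ℕ∞) X S.U) :
    ContDiffOn ℝ (⊤ : ℕ∞) (vecF S.ψ X) S.U :=
  S.contDiffOn_Dflat hX S.hψ

theorem contDiffOn_B {X Y : Pt → Pt} (hX : ContDiffOn ℝ (⊤ : ℕ∞) X S.U)
    (hY : ContDiffOn ℝ (⊤ : ℕ∞) Y S.U) : ContDiffOn ℝ (⊤ : ℕ∞) (S.B X Y) S.U :=
  (S.contDiffOn_Dflat hX (S.contDiffOn_vecF hY)).sub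
    (S.contDiffOn_vecF (S.hconnSmooth X Y hX hY))

variable {S}

theorem differentiableAt_of_contDiffOn {F : Type*} [NormedAddCommGroup F] [NormedSpace ℝ F]
    {f : Pt → F} (hf : ContDiffOn ℝ (⊤ : ℕ∞) f S.U) {p : Pt} (hp : p ∈ S.U) :
    DifferentiableAt ℝ f p :=
  (hf.contDiffAt (S.hUopen.mem_nhds hp)).differentiableAt (by simp)

theorem B_normal (X : Pt → Pt) {Y : Pt → Pt} (hY : ContDiffOn ℝ (⊤ : ℕ∞) Y S.U)
    {p : Pt} (hp : p ∈ S.U) : isNormalV S.ψ p (S.B X Y p) :=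
  S.hconn X Y p hp (differentiableAt_of_contDiffOn (S.contDiffOn_vecF hY) hp)

/-- Pairing with a normal vector only sees the second fundamental form. -/
theorem mink_Dflat_of_isNormalV (X Y : Pt → Pt) {p : Pt} {ν : E4} (hν : isNormalV S.ψ p ν) :
    mink (Dflat X (vecF S.ψ Y) p) ν = mink (S.B X Y p) ν := by
  have h := hν (S.conn X Y p)
  rw [mink_comm] at h
  simp only [B, sff, mink_sub_left, vecF] at h ⊢
  rw [h, sub_zero]

/-- Pairing with a tangent vector only sees the tangential connection. -/
theorem mink_conn (X : Pt → Pt) {Y : Pt → Pt} (hY : ContDiffOn ℝ (⊤ : ℕ∞) Y S.U)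
    {p : Pt} (hp : p ∈ S.U) (w : Pt) :
    mink (fderiv ℝ S.ψ p (S.conn X Y p)) (fderiv ℝ S.ψ p w) =
      mink (Dflat X (vecF S.ψ Y) p) (fderiv ℝ S.ψ p w) := by
  have h := B_normal X hY hp w
  simp only [B, sff, mink_sub_left, vecF] at h ⊢
  linarith

/-- Symmetry of the second fundamental form, paired with a normal vector. -/
theorem mink_B_symm {X Y : Pt → Pt} (hX : ContDiffOn ℝ (⊤ : ℕ∞) X S.U)
    (hY : ContDiffOn ℝ (⊤ : ℕ∞) Y S.U) {p : Pt} (hp : p ∈ S.U) {ν : E4}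
    (hν : isNormalV S.ψ p ν) : mink (S.B X Y p) ν = mink (S.B Y X p) ν := by
  have h := congrArg (fun v => mink v ν)
    (Dflat_comm (S.hψ.contDiffAt (S.hUopen.mem_nhds hp))
      (differentiableAt_of_contDiffOn hX hp) (differentiableAt_of_contDiffOn hY hp))
  have h1 := mink_Dflat_of_isNormalV X Y hν
  have h2 := mink_Dflat_of_isNormalV Y X hν
  have h3 := hν (lieB X Y p)
  rw [mink_comm] at h3
  have h0 : mink 0 ν = 0 := by simp [mink]
  simp only [mink_add_left, mink_sub_left, h0] at h
  change mink (Dflat X (Dflat Y S.ψ) p) ν = _ at h1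
  change mink (Dflat Y (Dflat X S.ψ) p) ν = _ at h2
  change mink (Dflat (lieB X Y) S.ψ p) ν = _ at h3
  linarith

/-- Tangential part of an iterated covariant derivative. -/
theorem mink_conn_conn {X Y V W : Pt → Pt} (hX : ContDiffOn ℝ (⊤ : ℕ∞) X S.U)
    (hV : ContDiffOn ℝ (⊤ : ℕ∞) V S.U) (hW : ContDiffOn ℝ (⊤ : ℕ∞) W S.U)
    {p : Pt} (hp : p ∈ S.U) :
    mink (fderiv ℝ S.ψ p (S.conn Y (S.conn X V) p)) (vecF S.ψ W p) =
      mink (Dflat Y (Dflat X (vecF S.ψ V)) p) (vecF S.ψ W p) +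
        mink (S.B X V p) (S.B Y W p) := by
  have hB := differentiableAt_of_contDiffOn (S.contDiffOn_B hX hV) hp
  have hD := differentiableAt_of_contDiffOn (S.contDiffOn_Dflat hX (S.contDiffOn_vecF hV)) hp
  have hWd := differentiableAt_of_contDiffOn (S.contDiffOn_vecF hW) hp
  have hl := mink_fderiv_of_orthogonal hB hWd
    (Filter.eventually_of_mem (S.hUopen.mem_nhds hp) fun q hq => B_normal X hV hq (W q)) (Y p)
  have hn := mink_Dflat_of_isNormalV Y W (B_normal X hV hp)
  have he : vecF S.ψ (S.conn X V) = fun q => Dflat X (vecF S.ψ V) q - S.B X V q := by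
    funext q
    simp [B, sff]
  have hd : Dflat Y (vecF S.ψ (S.conn X V)) p =
      Dflat Y (Dflat X (vecF S.ψ V)) p - fderiv ℝ (S.B X V) p (Y p) := by
    rw [he]
    exact congrArg (fun L : Pt →L[ℝ] E4 => L (Y p)) (fderiv_fun_sub hD hB)
  have hc := mink_conn Y (S.hconnSmooth X V hX hV) hp (W p)
  rw [hd, mink_sub_left] at hc
  change _ = _ - mink _ (vecF S.ψ W p) at hc
  rw [hl, mink_comm (S.B X V p)] at hc
  change _ = _ - -mink (Dflat Y (vecF S.ψ W) p) _ at hc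
  rw [hn, mink_comm (S.B Y W p), sub_neg_eq_add] at hc
  exact hc

/-- The Gauss equation. -/
theorem mink_curvR {X Y V W : Pt → Pt} (hX : ContDiffOn ℝ (⊤ : ℕ∞) X S.U)
    (hY : ContDiffOn ℝ (⊤ : ℕ∞) Y S.U) (hV : ContDiffOn ℝ (⊤ : ℕ∞) V S.U)
    (hW : ContDiffOn ℝ (⊤ : ℕ∞) W S.U) {p : Pt} (hp : p ∈ S.U) :
    mink (fderiv ℝ S.ψ p (curvR S.conn X Y V p)) (fderiv ℝ S.ψ p (W p)) =
      mink (S.B X V p) (S.B Y W p) - mink (S.B Y V p) (S.B X W p) := by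
  have h1 := mink_conn_conn (Y := Y) hX hV hW hp
  have h2 := mink_conn_conn (Y := X) hY hV hW hp
  have h3 := mink_conn (lieB X Y) hV hp (W p)
  have h := congrArg (fun v => mink v (vecF S.ψ W p))
    (Dflat_comm ((S.contDiffOn_vecF hV).contDiffAt (S.hUopen.mem_nhds hp))
      (differentiableAt_of_contDiffOn hX hp) (differentiableAt_of_contDiffOn hY hp))
  have h0 : mink 0 (vecF S.ψ W p) = 0 := by simp [mink]
  simp only [mink_add_left, mink_sub_left, h0] at h
  change mink _ (vecF S.ψ W p) = mink _ (vecF S.ψ W p) at h3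
  change mink _ (vecF S.ψ W p) = _
  simp only [curvR, map_add, map_sub, mink_add_left, mink_sub_left]
  linarith

end CNND

/-- The Gauss curvature of `M` is given by `K = a β(Z^⊤)`. -/
theorem cnnd_gauss_curvature_beta_formula (S : CNND) :
    ∀ p ∈ S.U, S.Kfun p = S.afun p * S.beta p (S.ZT p) := by
  intro p hp
  have hN : isNormalV S.ψ p (S.Zperp p) := S.hZTtangentpart p hp
  have hnull : mink (S.Zperp p) (S.Zperp p) = 0 := S.hZperpNull p hp
  have hβ : ∀ X, S.B X S.ZT p = S.beta p (X p) • S.Zperp p := fun X => S.hbeta X p hp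
  have hsymm := CNND.mink_B_symm S.hZTsmooth S.hWsmooth hp hN
  rw [hβ, mink_smul_left, hnull, mul_zero] at hsymm
  have hK : S.Kfun p = _ :=
    CNND.mink_curvR S.hZTsmooth S.hWsmooth S.hZTsmooth S.hWsmooth hp
  rw [hK, hβ, hβ, mink_smul_left, mink_smul_left, mink_comm _ (S.B S.ZT S.Wc p), hsymm,
    mink_comm, CNND.afun]
  ring

end
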